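/- If μ ≥ 0, then e_μ(x) ≥ 0 for all x ∈ ℝ. -/

import Mathlib

open MeasureTheory Real Set

/-- The generalized factorial γ_μ: γ_μ(2m) = 2^{2m} m! Γ(m+μ+1/2)/Γ(μ+1/2),
γ_μ(2m+1) = 2^{2m+1} m! Γ(m+μ+3/2)/Γ(μ+1/2). -/
noncomputable def genGamma (μ : ℝ) (n : ℕ) : ℝ :=
  if Even n then
    2 ^ n * (Nat.factorial (n / 2)) * Real.Gamma (((n / 2 : ℕ) : ℝ) + μ + 1 / 2) /
      Real.Gamma (μ + 1 / 2)
  else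
    2 ^ n * (Nat.factorial (n / 2)) * Real.Gamma (((n / 2 : ℕ) : ℝ) + μ + 3 / 2) /
      Real.Gamma (μ + 1 / 2)

/-- The generalized exponential function e_μ(x) = Σ_{m} x^m / γ_μ(m). -/
noncomputable def genExp (μ : ℝ) (x : ℝ) : ℝ := ∑' m : ℕ, x ^ m / genGamma μ m

theorem genGamma_zero {μ : ℝ} (hμ : 0 ≤ μ) : genGamma μ 0 = 1 := by
  have h : Real.Gamma (μ + 1 / 2) ≠ 0 := (Real.Gamma_pos_of_pos (by linarith)).ne'
  simpa [genGamma] using div_self h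

theorem genGamma_succ {μ : ℝ} (hμ : 0 ≤ μ) (n : ℕ) :
    genGamma μ (n + 1) = ((n : ℝ) + 1 + if Even n then 2 * μ else 0) * genGamma μ n := by
  rcases Nat.even_or_odd' n with ⟨m, rfl | rfl⟩
  · have h₁ : ¬ Even (2 * m + 1) := by simp
    have h₂ : Even (2 * m) := by simp
    have h₃ : (2 * m + 1) / 2 = m := by omega
    have h₄ : 2 * m / 2 = m := by omega
    have h₅ : (m : ℝ) + μ + 3 / 2 = ((m : ℝ) + μ + 1 / 2) + 1 := by ring
    simp only [genGamma, h₁, h₂, h₃, h₄, if_true, if_false]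
    rw [h₅, Real.Gamma_add_one (by positivity)]
    push_cast
    ring
  · have h₁ : ¬ Even (2 * m + 1) := by simp
    have h₂ : Even (2 * m + 1 + 1) := ⟨m + 1, by ring⟩
    have h₃ : (2 * m + 1) / 2 = m := by omega
    have h₄ : (2 * m + 1 + 1) / 2 = m + 1 := by omega
    have h₅ : ((m + 1 : ℕ) : ℝ) + μ + 1 / 2 = (m : ℝ) + μ + 3 / 2 := by push_cast; ring
    simp only [genGamma, h₁, h₂, h₃, h₄, if_true, if_false, h₅, Nat.factorial_succ]
    push_cast
    ring

theorem factorial_le_genGamma {μ : ℝ} (hμ : 0 ≤ μ) (n : ℕ) :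
    (n.factorial : ℝ) ≤ genGamma μ n := by
  induction n with
  | zero => simp [genGamma_zero hμ]
  | succ n ih =>
    rw [genGamma_succ hμ, Nat.factorial_succ]
    push_cast
    have h : (0 : ℝ) ≤ if Even n then 2 * μ else 0 := by split_ifs <;> positivity
    exact mul_le_mul (by linarith) ih (by positivity) (by positivity)

theorem genGamma_pos {μ : ℝ} (hμ : 0 ≤ μ) (n : ℕ) : 0 < genGamma μ n :=
  (Nat.cast_pos.mpr n.factorial_pos).trans_le (factorial_le_genGamma hμ n)

theorem summable_norm_pow_div_genGamma {μ : ℝ} (hμ : 0 ≤ μ) (x : ℝ) :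
    Summable fun n : ℕ => ‖x ^ n / genGamma μ n‖ := by
  refine Summable.of_nonneg_of_le (fun _ => norm_nonneg _) (fun n => ?_)
    (Real.summable_pow_div_factorial |x|)
  rw [norm_div, norm_pow, Real.norm_eq_abs, Real.norm_of_nonneg (genGamma_pos hμ n).le]
  exact div_le_div_of_nonneg_left (by positivity) (by positivity) (factorial_le_genGamma hμ n)

theorem add_one_mul_neg_one_pow_div_genGamma_succ_ge {μ : ℝ} (hμ : 0 ≤ μ) (n : ℕ) :
    -((-1) ^ n / genGamma μ n) ≤ ((n : ℝ) + 1) * ((-1) ^ (n + 1) / genGamma μ (n + 1)) := by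
  have h := genGamma_pos hμ n
  rw [genGamma_succ hμ]
  rcases Nat.even_or_odd n with hn | hn
  · rw [if_pos hn, pow_succ, hn.neg_one_pow, ← sub_nonneg]
    have : ((n : ℝ) + 1) * (1 * -1 / (((n : ℝ) + 1 + 2 * μ) * genGamma μ n)) -
        -(1 / genGamma μ n) = 2 * μ / (((n : ℝ) + 1 + 2 * μ) * genGamma μ n) := by
      have : (n : ℝ) + 1 + 2 * μ ≠ 0 := by positivity
      field_simp
      ring
    rw [this]
    positivity
  · rw [if_neg (Nat.not_even_iff_odd.mpr hn), pow_succ, hn.neg_one_pow]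
    apply le_of_eq
    field_simp
    ring

/-- The Taylor coefficients of `exp x * e_μ(-x)` are nonnegative. -/
theorem sum_antidiagonal_neg_one_pow_div_genGamma_nonneg {μ : ℝ} (hμ : 0 ≤ μ) (n : ℕ) :
    0 ≤ ∑ p ∈ Finset.HasAntidiagonal.antidiagonal n,
      ((-1) ^ p.1 / genGamma μ p.1) * (1 / (p.2.factorial : ℝ)) := by
  rcases n with _ | n
  · simp [genGamma_zero hμ]
  set a : ℕ → ℝ := fun k => (-1) ^ k / genGamma μ k with ha
  set d : ℕ → ℝ := fun k => 1 / (k.factorial : ℝ) with hd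
  change 0 ≤ ∑ p ∈ Finset.HasAntidiagonal.antidiagonal (n + 1), a p.1 * d p.2
  have hd_succ (k : ℕ) : ((k : ℝ) + 1) * d (k + 1) = d k := by
    simp only [hd, Nat.factorial_succ]
    push_cast
    field_simp
  have hsplit : ((n : ℝ) + 1) * ∑ p ∈ Finset.HasAntidiagonal.antidiagonal (n + 1), a p.1 * d p.2 =
      ∑ p ∈ Finset.HasAntidiagonal.antidiagonal (n + 1), (p.1 : ℝ) * a p.1 * d p.2 +
      ∑ p ∈ Finset.HasAntidiagonal.antidiagonal (n + 1), a p.1 * ((p.2 : ℝ) * d p.2) := by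
    rw [Finset.mul_sum, ← Finset.sum_add_distrib]
    refine Finset.sum_congr rfl fun p hp => ?_
    have : (p.1 : ℝ) + p.2 = n + 1 := by exact_mod_cast Finset.HasAntidiagonal.mem_antidiagonal.mp hp
    rw [← this]
    ring
  rw [Finset.Nat.sum_antidiagonal_succ
    (f := fun p => (p.1 : ℝ) * a p.1 * d p.2), Finset.Nat.sum_antidiagonal_succ'
    (f := fun p => a p.1 * ((p.2 : ℝ) * d p.2))] at hsplit
  simp only [Nat.cast_zero, zero_mul, mul_zero, zero_add, Nat.cast_add, Nat.cast_one,
    hd_succ, ← Finset.sum_add_distrib] at hsplit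
  refine nonneg_of_mul_nonneg_right (a := (n : ℝ) + 1) ?_ (by positivity)
  rw [hsplit]
  refine Finset.sum_nonneg fun p _ => ?_
  rw [← add_mul]
  refine mul_nonneg ?_ (by positivity)
  linarith [add_one_mul_neg_one_pow_div_genGamma_succ_ge hμ p.1]

theorem exp_mul_genExp_neg_nonneg {μ : ℝ} (hμ : 0 ≤ μ) {x : ℝ} (hx : 0 ≤ x) :
    0 ≤ genExp μ (-x) * Real.exp x := by
  have hexp : Summable fun n : ℕ => ‖x ^ n / (n.factorial : ℝ)‖ :=
    (Real.summable_pow_div_factorial x).norm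
  rw [Real.exp_eq_exp_ℝ, NormedSpace.exp_eq_tsum_div, genExp,
    tsum_mul_tsum_eq_tsum_sum_antidiagonal_of_summable_norm
      (summable_norm_pow_div_genGamma hμ (-x)) hexp]
  refine tsum_nonneg fun n => ?_
  have : ∑ p ∈ Finset.HasAntidiagonal.antidiagonal n,
      (-x) ^ p.1 / genGamma μ p.1 * (x ^ p.2 / (p.2.factorial : ℝ)) =
      x ^ n * ∑ p ∈ Finset.HasAntidiagonal.antidiagonal n,
        ((-1) ^ p.1 / genGamma μ p.1) * (1 / (p.2.factorial : ℝ)) := by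
    rw [Finset.mul_sum]
    refine Finset.sum_congr rfl fun p hp => ?_
    rw [← Finset.HasAntidiagonal.mem_antidiagonal.mp hp, pow_add, neg_pow]
    ring
  rw [this]
  exact mul_nonneg (pow_nonneg hx n) (sum_antidiagonal_neg_one_pow_div_genGamma_nonneg hμ n)

/-- If μ ≥ 0 then e_μ(x) ≥ 0 for all x ∈ ℝ. -/
theorem genExp_nonneg (μ : ℝ) (hμ : 0 ≤ μ) : ∀ x : ℝ, 0 ≤ genExp μ x := by
  intro x
  rcases le_total 0 x with hx | hx
  · exact tsum_nonneg fun n => div_nonneg (pow_nonneg hx n) (genGamma_pos hμ n).le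
  · have h := exp_mul_genExp_neg_nonneg hμ (neg_nonneg.mpr hx)
    rw [neg_neg] at h
    exact nonneg_of_mul_nonneg_left h (Real.exp_pos _)
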